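/- Let k ≥ 6 be even, let s, w ∈ ℂ satisfy 2 < Re(s) < k−2 and Re(w) < min{Re(s)−1, k−1−Re(s)}, and let z = (z₁,z₂) ∈ ℍ². Then ζ_F(1−w+s)·ζ_F(1−w+k−s)·E_{s,k−s}(z;w) = Σ_{γ ∈ Ã\M⁺} (σ₁(det γ))^{w−1}·(σ₂(det γ))^{w−1}·(γ₁z₁)^{−s}·(γ₂z₂)^{−s}·j(γ,z)^{−k·1}, where M⁺ is the set of all 2×2 matrices over O with totally positive determinant, Ã = {diag(u,v) : u, v ∈ O₊^×} acts on M⁺ by left multiplication, the summand is Ã-invariant, and the series on the right converges absolutely. -/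

import Mathlib

open Complex

noncomputable section

namespace HilbertPaper

/-- Möbius action of a real 2×2 matrix on a complex number. -/
def moebius (g : Matrix (Fin 2) (Fin 2) ℝ) (z : ℂ) : ℂ :=
  (((g 0 0 : ℝ) : ℂ) * z + ((g 0 1 : ℝ) : ℂ)) / (((g 1 0 : ℝ) : ℂ) * z + ((g 1 1 : ℝ) : ℂ))

/-- Automorphy factor `j(g, z) = c z + d`. -/
def jfac (g : Matrix (Fin 2) (Fin 2) ℝ) (z : ℂ) : ℂ :=
  ((g 1 0 : ℝ) : ℂ) * z + ((g 1 1 : ℝ) : ℂ)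

variable (F : Type) [Field F] [NumberField F]

/-- The embedding of the ring of integers into ℝ induced by a real embedding σ of F. -/
def emb (σ : F →+* ℝ) : NumberField.RingOfIntegers F →+* ℝ :=
  σ.comp (algebraMap (NumberField.RingOfIntegers F) F)

/-- An element of F is totally positive when both real embeddings are positive on it. -/
def TotPos (σ₁ σ₂ : F →+* ℝ) (x : F) : Prop := 0 < σ₁ x ∧ 0 < σ₂ x

/-- `F` is a real quadratic field with narrow class number one, whose two real embeddings
are `σ₁ ≠ σ₂`; narrow class number one is expressed as: every nonzero ideal of the ring of
integers has a totally positive generator. -/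
def RealQuadNarrowOne (σ₁ σ₂ : F →+* ℝ) : Prop :=
  Module.finrank ℚ F = 2 ∧ σ₁ ≠ σ₂ ∧
    ∀ I : Ideal (NumberField.RingOfIntegers F), I ≠ ⊥ →
      ∃ a : NumberField.RingOfIntegers F,
        TotPos F σ₁ σ₂ (algebraMap (NumberField.RingOfIntegers F) F a) ∧ I = Ideal.span {a}

/-- Γ = SL₂(O). -/
abbrev SL2O := Matrix.SpecialLinearGroup (Fin 2) (NumberField.RingOfIntegers F)

/-- The real matrix obtained from γ ∈ SL₂(O) by applying σ entrywise. -/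
def mat (σ : F →+* ℝ) (γ : SL2O F) : Matrix (Fin 2) (Fin 2) ℝ :=
  (γ : Matrix (Fin 2) (Fin 2) (NumberField.RingOfIntegers F)).map (emb F σ)

/-- Membership in the subgroup A = {diag(ε, ε⁻¹) : ε a totally positive unit}. -/
def IsInA (σ₁ σ₂ : F →+* ℝ) (a : SL2O F) : Prop :=
  ∃ ε : (NumberField.RingOfIntegers F)ˣ,
    TotPos F σ₁ σ₂ (algebraMap (NumberField.RingOfIntegers F) F (ε : NumberField.RingOfIntegers F)) ∧
    (a : Matrix (Fin 2) (Fin 2) (NumberField.RingOfIntegers F)) =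
      !![(ε : NumberField.RingOfIntegers F), 0; 0, ((ε⁻¹ : (NumberField.RingOfIntegers F)ˣ) : NumberField.RingOfIntegers F)]

/-- The relation on Γ whose quotient is the coset space A\Γ. -/
def ARel (σ₁ σ₂ : F →+* ℝ) (γ γ' : SL2O F) : Prop :=
  ∃ a : SL2O F, IsInA F σ₁ σ₂ a ∧ γ' = a * γ

/-- The summand of the Cohen kernel: (γ₁z₁)^{-s} (γ₂z₂)^{-s} j(γ,z)^{-k·1}. -/
def cohenSummand (σ₁ σ₂ : F →+* ℝ) (k : ℕ) (s : ℂ) (z₁ z₂ : ℂ) (γ : SL2O F) : ℂ :=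
  moebius (mat F σ₁ γ) z₁ ^ (-s) * moebius (mat F σ₂ γ) z₂ ^ (-s) *
    (jfac (mat F σ₁ γ) z₁ ^ (-(k : ℤ)) * jfac (mat F σ₂ γ) z₂ ^ (-(k : ℤ)))


/-- Membership in Γ∞⁺, the upper-triangular elements of Γ with totally positive diagonal. -/
def IsInGammaInfPos (σ₁ σ₂ : F →+* ℝ) (p : SL2O F) : Prop :=
  (p : Matrix (Fin 2) (Fin 2) (NumberField.RingOfIntegers F)) 1 0 = 0 ∧
  TotPos F σ₁ σ₂ (algebraMap (NumberField.RingOfIntegers F) F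
    ((p : Matrix (Fin 2) (Fin 2) (NumberField.RingOfIntegers F)) 0 0)) ∧
  TotPos F σ₁ σ₂ (algebraMap (NumberField.RingOfIntegers F) F
    ((p : Matrix (Fin 2) (Fin 2) (NumberField.RingOfIntegers F)) 1 1))

/-- The relation on Γ whose quotient is the coset space Γ∞⁺\Γ. -/
def GammaInfRel (σ₁ σ₂ : F →+* ℝ) (γ γ' : SL2O F) : Prop :=
  ∃ p : SL2O F, IsInGammaInfPos F σ₁ σ₂ p ∧ γ' = p * γ

/-- The relation on Γ × Γ whose quotient is (Γ∞⁺\Γ)². -/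
def PairRel (σ₁ σ₂ : F →+* ℝ) (p q : SL2O F × SL2O F) : Prop :=
  GammaInfRel F σ₁ σ₂ p.1 q.1 ∧ GammaInfRel F σ₁ σ₂ p.2 q.2

/-- `c_{γδ⁻¹}`, the lower-left entry of γδ⁻¹. -/
def lowc (γ δ : SL2O F) : NumberField.RingOfIntegers F :=
  ((γ * δ⁻¹ : SL2O F) : Matrix (Fin 2) (Fin 2) (NumberField.RingOfIntegers F)) 1 0

/-- The summand of the double Eisenstein series E_{s, k-s}(z; w). -/
def dblSummand (σ₁ σ₂ : F →+* ℝ) (k : ℕ) (s w : ℂ) (z₁ z₂ : ℂ) (γ δ : SL2O F) : ℂ :=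
  ((σ₁ (algebraMap (NumberField.RingOfIntegers F) F (lowc F γ δ)) : ℝ) : ℂ) ^ (w - 1) *
  ((σ₂ (algebraMap (NumberField.RingOfIntegers F) F (lowc F γ δ)) : ℝ) : ℂ) ^ (w - 1) *
  ((jfac (mat F σ₁ γ) z₁ / jfac (mat F σ₁ δ) z₁) ^ (-s) *
   (jfac (mat F σ₂ γ) z₂ / jfac (mat F σ₂ δ) z₂) ^ (-s)) *
  (jfac (mat F σ₁ δ) z₁ ^ (-(k : ℤ)) * jfac (mat F σ₂ δ) z₂ ^ (-(k : ℤ)))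

open Classical in
/-- The summand of the double Eisenstein series, extended by zero to pairs whose
`c_{γδ⁻¹}` is not totally positive. -/
def dblExt (σ₁ σ₂ : F →+* ℝ) (k : ℕ) (s w : ℂ) (z₁ z₂ : ℂ) (γ δ : SL2O F) : ℂ :=
  if TotPos F σ₁ σ₂ (algebraMap (NumberField.RingOfIntegers F) F (lowc F γ δ)) then
    dblSummand F σ₁ σ₂ k s w z₁ z₂ γ δ
  else 0

/-- The value of the Dedekind zeta function of F at `u` (for `Re u > 1`), as the absolutely
convergent sum over nonzero integral ideals of `N(𝔞)^{-u}`. -/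
def zetaVal (u : ℂ) : ℂ :=
  ∑' I : {I : Ideal (NumberField.RingOfIntegers F) // I ≠ ⊥}, (Ideal.absNorm I.1 : ℂ) ^ (-u)

/-- `M⁺`: the 2×2 matrices over O with totally positive determinant. -/
abbrev Mplus (σ₁ σ₂ : F →+* ℝ) :=
  {m : Matrix (Fin 2) (Fin 2) (NumberField.RingOfIntegers F) //
    TotPos F σ₁ σ₂ (algebraMap (NumberField.RingOfIntegers F) F m.det)}

/-- Membership in `Ã = {diag(u,v) : u, v totally positive units}` applied on the left:
the relation on `M⁺` whose quotient is `Ã\M⁺`. -/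
def AtildeRel (σ₁ σ₂ : F →+* ℝ) (m m' : Mplus F σ₁ σ₂) : Prop :=
  ∃ u v : (NumberField.RingOfIntegers F)ˣ,
    TotPos F σ₁ σ₂ (algebraMap (NumberField.RingOfIntegers F) F (u : NumberField.RingOfIntegers F)) ∧
    TotPos F σ₁ σ₂ (algebraMap (NumberField.RingOfIntegers F) F (v : NumberField.RingOfIntegers F)) ∧
    m'.1 = !![(u : NumberField.RingOfIntegers F), 0; 0, (v : NumberField.RingOfIntegers F)] * m.1

/-- The summand `(σ₁ det γ)^{w-1} (σ₂ det γ)^{w-1} (γ₁z₁)^{-s} (γ₂z₂)^{-s} j(γ,z)^{-k·1}`. -/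
def mplusSummand (σ₁ σ₂ : F →+* ℝ) (k : ℕ) (s w : ℂ) (z₁ z₂ : ℂ)
    (m : Matrix (Fin 2) (Fin 2) (NumberField.RingOfIntegers F)) : ℂ :=
  ((emb F σ₁ m.det : ℝ) : ℂ) ^ (w - 1) * ((emb F σ₂ m.det : ℝ) : ℂ) ^ (w - 1) *
  (moebius (m.map (emb F σ₁)) z₁ ^ (-s) * moebius (m.map (emb F σ₂)) z₂ ^ (-s)) *
  (jfac (m.map (emb F σ₁)) z₁ ^ (-(k : ℤ)) * jfac (m.map (emb F σ₂)) z₂ ^ (-(k : ℤ)))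

set_option linter.unusedSectionVars false

section Arithmetic

variable {F} {σ₁ σ₂ : F →+* ℝ}

open NumberField

/-- The larger of the absolute values of `x` at the two real embeddings. -/
def supEmb (σ₁ σ₂ : F →+* ℝ) (x : 𝓞 F) : ℝ := max |emb F σ₁ x| |emb F σ₂ x|

lemma ofReal_comp_ne (h : σ₁ ≠ σ₂) : Complex.ofRealHom.comp σ₁ ≠ Complex.ofRealHom.comp σ₂ := by
  intro e
  apply h
  ext x
  exact Complex.ofReal_injective (RingHom.congr_fun e x)

lemma univ_embeddings [DecidableEq (F →+* ℂ)] (hd : Module.finrank ℚ F = 2) (h : σ₁ ≠ σ₂) :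
    (Finset.univ : Finset (F →+* ℂ)) =
      {Complex.ofRealHom.comp σ₁, Complex.ofRealHom.comp σ₂} := by
  symm
  apply Finset.eq_univ_of_card
  rw [Finset.card_pair (ofReal_comp_ne h), Embeddings.card, hd]

lemma norm_eq_mul (hd : Module.finrank ℚ F = 2) (h : σ₁ ≠ σ₂) (x : F) :
    ((Algebra.norm ℚ x : ℚ) : ℝ) = σ₁ x * σ₂ x := by
  classical
  have h1 := Algebra.norm_eq_prod_embeddings ℚ ℂ x
  have h2 : ∏ σ : F →ₐ[ℚ] ℂ, σ x = ∏ φ : F →+* ℂ, φ x :=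
    Fintype.prod_equiv (RingHom.equivRatAlgHom F ℂ).symm _ _ (fun _ ↦ rfl)
  rw [h2, univ_embeddings hd h, Finset.prod_pair (ofReal_comp_ne h)] at h1
  apply Complex.ofReal_injective
  simpa using h1

lemma int_norm_eq_mul (hd : Module.finrank ℚ F = 2) (h : σ₁ ≠ σ₂) (x : 𝓞 F) :
    ((Algebra.norm ℤ x : ℤ) : ℝ) = emb F σ₁ x * emb F σ₂ x := by
  have h1 := norm_eq_mul hd h (x : F)
  rw [← Algebra.coe_norm_int] at h1
  simpa [emb] using h1

lemma one_le_abs_mul (hd : Module.finrank ℚ F = 2) (h : σ₁ ≠ σ₂) {x : 𝓞 F} (hx : x ≠ 0) :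
    1 ≤ |emb F σ₁ x| * |emb F σ₂ x| := by
  rw [← abs_mul, ← int_norm_eq_mul hd h]
  exact_mod_cast Int.one_le_abs (Algebra.norm_ne_zero_iff.2 hx)

lemma unit_abs_mul (hd : Module.finrank ℚ F = 2) (h : σ₁ ≠ σ₂) (u : (𝓞 F)ˣ) :
    |emb F σ₁ u| * |emb F σ₂ u| = 1 := by
  have h1 : |(Algebra.norm ℤ (u : 𝓞 F))| = 1 :=
    Int.isUnit_iff_abs_eq.1 (u.isUnit.map _)
  rw [← abs_mul, ← int_norm_eq_mul hd h]
  exact_mod_cast h1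

lemma absNorm_span_eq (hd : Module.finrank ℚ F = 2) (h : σ₁ ≠ σ₂) {x : 𝓞 F}
    (hx : TotPos F σ₁ σ₂ x) :
    (Ideal.absNorm (Ideal.span {x}) : ℝ) = emb F σ₁ x * emb F σ₂ x := by
  have h0 : 0 < emb F σ₁ x * emb F σ₂ x := mul_pos hx.1 hx.2
  have h1 := int_norm_eq_mul hd h x
  rw [Ideal.absNorm_span_singleton, ← abs_of_pos h0, ← h1, Nat.cast_natAbs]
  push_cast
  rfl

lemma TotPos.ne_zero {x : 𝓞 F} (hx : TotPos F σ₁ σ₂ x) : x ≠ 0 := by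
  rintro rfl
  simpa using hx.1

lemma TotPos.mul {x y : 𝓞 F} (hx : TotPos F σ₁ σ₂ x) (hy : TotPos F σ₁ σ₂ y) :
    TotPos F σ₁ σ₂ (x * y : 𝓞 F) := by
  simp only [TotPos, map_mul]
  exact ⟨mul_pos hx.1 hy.1, mul_pos hx.2 hy.2⟩

lemma TotPos.of_mul {x y : 𝓞 F} (hx : TotPos F σ₁ σ₂ x) (h : TotPos F σ₁ σ₂ (x * y : 𝓞 F)) :
    TotPos F σ₁ σ₂ y := by
  simp only [TotPos, map_mul] at h
  exact ⟨pos_of_mul_pos_right h.1 hx.1.le, pos_of_mul_pos_right h.2 hx.2.le⟩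

lemma totPos_one : TotPos F σ₁ σ₂ (1 : 𝓞 F) := by simp [TotPos]

lemma TotPos.inv {u : (𝓞 F)ˣ} (h : TotPos F σ₁ σ₂ (u : 𝓞 F)) :
    TotPos F σ₁ σ₂ ((u⁻¹ : (𝓞 F)ˣ) : 𝓞 F) :=
  h.of_mul (by rw [Units.mul_inv]; exact totPos_one)

lemma TotPos.zpow {u : (𝓞 F)ˣ} (h : TotPos F σ₁ σ₂ (u : 𝓞 F)) (n : ℤ) :
    TotPos F σ₁ σ₂ ((u ^ n : (𝓞 F)ˣ) : 𝓞 F) := by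
  have hp : ∀ m : ℕ, TotPos F σ₁ σ₂ ((u ^ m : (𝓞 F)ˣ) : 𝓞 F) := fun m ↦ by
    induction m with
    | zero => simp [TotPos]
    | succ m ih =>
      rw [pow_succ, Units.val_mul]
      exact ih.mul h
  cases n with
  | ofNat m => simpa using hp m
  | negSucc m =>
    rw [zpow_negSucc]
    exact (hp _).inv

lemma TotPos.unit_mul (hd : Module.finrank ℚ F = 2) (h : σ₁ ≠ σ₂) {u : (𝓞 F)ˣ}
    (hu : TotPos F σ₁ σ₂ (u : 𝓞 F)) : emb F σ₁ u * emb F σ₂ u = 1 := by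
  have := unit_abs_mul hd h u
  rwa [abs_of_pos (show 0 < emb F σ₁ u from hu.1),
    abs_of_pos (show 0 < emb F σ₂ u from hu.2)] at this

/-- There is a totally positive unit of infinite order. -/
lemma exists_totPos_unit (hd : Module.finrank ℚ F = 2) (h : σ₁ ≠ σ₂) :
    ∃ u : (𝓞 F)ˣ, TotPos F σ₁ σ₂ (u : 𝓞 F) ∧ 1 < emb F σ₁ u := by
  obtain ⟨u, hu⟩ := Units.dirichletUnitTheorem.exists_unit F
    (InfinitePlace.mk (Complex.ofRealHom.comp σ₁))
  have hne : InfinitePlace.mk (Complex.ofRealHom.comp σ₂) ≠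
      InfinitePlace.mk (Complex.ofRealHom.comp σ₁) := by
    intro e
    rcases InfinitePlace.mk_eq_iff.1 e with e | e
    · exact ofReal_comp_ne h e.symm
    · apply ofReal_comp_ne h
      rw [← e]
      ext x
      simp
  have h2 := hu _ hne
  have e2 : InfinitePlace.mk (Complex.ofRealHom.comp σ₂) ((u : 𝓞 F) : F) = |emb F σ₂ u| := by
    simp [InfinitePlace.apply, emb]
  rw [e2] at h2
  have hm := unit_abs_mul hd h u
  have hp1 : 0 < |emb F σ₁ u| := by
    rcases (abs_nonneg (emb F σ₁ u)).eq_or_lt with h0 | h0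
    · rw [← h0] at hm; simp at hm
    · exact h0
  have hp2 : 0 < |emb F σ₂ u| := by
    rcases (abs_nonneg (emb F σ₂ u)).eq_or_lt with h0 | h0
    · rw [← h0] at hm; simp at hm
    · exact h0
  have hlt : |emb F σ₂ u| < 1 := by
    by_contra! hc
    exact absurd h2 (not_lt.2 (Real.log_nonneg hc))
  have hgt : 1 < |emb F σ₁ u| := by
    by_contra! hc
    nlinarith
  refine ⟨u ^ 2, ⟨?_, ?_⟩, ?_⟩
  · have : 0 < (emb F σ₁ u) ^ 2 := by rw [← sq_abs]; positivity
    simpa [emb] using this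
  · have : 0 < (emb F σ₂ u) ^ 2 := by rw [← sq_abs]; positivity
    simpa [emb] using this
  · rw [Units.val_pow_eq_pow_val, map_pow, ← sq_abs]
    nlinarith

lemma summable_supEmb_rpow (hd : Module.finrank ℚ F = 2) (h : σ₁ ≠ σ₂) {α : ℝ} (hα : 2 < α) :
    Summable fun x : 𝓞 F ↦ (max 1 (supEmb σ₁ σ₂ x)) ^ (-α) := by
  classical
  let L := mixedEmbedding.integerLattice F
  have hrk : Module.finrank ℤ L = 2 := by
    rw [ZLattice.rank ℝ L, mixedEmbedding.finrank, hd]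
  have hs := ZLattice.summable_norm_rpow L (-α) (by rw [hrk]; push_cast; linarith)
  let f : 𝓞 F → L := fun x ↦ ⟨mixedEmbedding F x, ⟨x, rfl⟩⟩
  have hf : Function.Injective f := fun x y e ↦ by
    have := congrArg Subtype.val e
    exact RingOfIntegers.coe_injective (mixedEmbedding_injective F this)
  have hs2 := hs.comp_injective hf
  refine Summable.of_norm_bounded_eventually hs2 ?_
  rw [Filter.eventually_cofinite]
  refine (Set.finite_singleton (0 : 𝓞 F)).subset fun x hx ↦ ?_
  by_contra hx0
  apply hx
  have hx0' : x ≠ 0 := hx0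
  have hle : ‖f x‖ ≤ supEmb σ₁ σ₂ x := by
    change ‖mixedEmbedding F (x : F)‖ ≤ _
    rw [mixedEmbedding.norm_eq_sup'_normAtPlace]
    refine Finset.sup'_le _ _ fun w _ ↦ ?_
    rw [mixedEmbedding.normAtPlace_apply, ← InfinitePlace.norm_embedding_eq]
    have hw : w.embedding ∈ (Finset.univ : Finset (F →+* ℂ)) := Finset.mem_univ _
    rw [univ_embeddings hd h, Finset.mem_insert, Finset.mem_singleton] at hw
    rcases hw with hw | hw <;> rw [hw] <;> simp [supEmb, emb]
  have hpos : 0 < ‖f x‖ := by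
    rw [norm_pos_iff]
    intro e
    apply hx0'
    apply hf
    rw [e]
    ext1
    simp [f]
  rw [Real.norm_of_nonneg (by positivity)]
  exact Real.rpow_le_rpow_of_nonpos hpos (hle.trans (le_max_right _ _)) (by linarith)

end Arithmetic

section Bounds

variable {F} {σ₁ σ₂ : F →+* ℝ}

open NumberField

lemma exists_max_abs_le {z : ℂ} (hz : 0 < z.im) :
    ∃ K : ℝ, 0 < K ∧ ∀ a b : ℝ, max |a| |b| ≤ K * ‖(a : ℂ) * z + b‖ := by
  have ha : ∀ a b : ℝ, |a| ≤ z.im⁻¹ * ‖(a : ℂ) * z + b‖ := fun a b ↦ by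
    have h1 := Complex.abs_im_le_norm ((a : ℂ) * z + b)
    have h2 : ((a : ℂ) * z + b).im = a * z.im := by simp
    rw [h2, abs_mul, abs_of_pos hz] at h1
    rw [inv_mul_eq_div, le_div_iff₀ hz]
    exact h1
  refine ⟨z.im⁻¹ + (1 + z.im⁻¹ * ‖z‖), by positivity, fun a b ↦ max_le ?_ ?_⟩
  · refine (ha a b).trans ?_
    gcongr
    have : 0 ≤ 1 + z.im⁻¹ * ‖z‖ := by positivity
    linarith
  · have h1 : |b| ≤ ‖(a : ℂ) * z + b‖ + |a| * ‖z‖ := by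
      have := norm_sub_le ((a : ℂ) * z + b) ((a : ℂ) * z)
      simpa using this
    have h2 : |a| * ‖z‖ ≤ z.im⁻¹ * ‖(a : ℂ) * z + b‖ * ‖z‖ :=
      mul_le_mul_of_nonneg_right (ha a b) (norm_nonneg z)
    have h3 : 0 ≤ z.im⁻¹ * ‖(a : ℂ) * z + b‖ := by positivity
    nlinarith

lemma det_mul_im_le (z : ℂ) (a b c d : ℝ) :
    (a * d - b * c) * z.im ≤ ‖(a : ℂ) * z + b‖ * ‖(c : ℂ) * z + d‖ := by
  have h1 := Complex.abs_im_le_norm (((a : ℂ) * z + b) * (starRingEnd ℂ) ((c : ℂ) * z + d))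
  rw [norm_mul, RCLike.norm_conj] at h1
  refine le_trans (le_of_eq ?_) ((le_abs_self _).trans h1)
  simp
  ring

lemma norm_cpow_neg_le (x s : ℂ) :
    ‖x ^ (-s)‖ ≤ Real.exp (Real.pi * |s.im|) * ‖x‖ ^ (-s.re) := by
  refine (Complex.norm_cpow_le x (-s)).trans ?_
  rw [div_eq_mul_inv, ← Real.exp_neg, mul_comm]
  simp only [Complex.neg_re, Complex.neg_im]
  refine mul_le_mul_of_nonneg_right (Real.exp_le_exp.2 ?_) (by positivity)
  have h1 : |x.arg * s.im| ≤ Real.pi * |s.im| := by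
    rw [abs_mul]
    exact mul_le_mul_of_nonneg_right (Complex.abs_arg_le_pi x) (abs_nonneg _)
  have h2 := le_abs_self (x.arg * s.im)
  linarith

/-- The larger of the absolute values of the entries of the row `(x, y)` under `σ`. -/
def rowMax (σ : F →+* ℝ) (x y : 𝓞 F) : ℝ := max |emb F σ x| |emb F σ y|

/-- The sizes of the row `(x, y)` at the two places agree up to the factor `R`. -/
def Balanced (σ₁ σ₂ : F →+* ℝ) (R : ℝ) (x y : 𝓞 F) : Prop :=
  rowMax σ₁ x y ≤ R * rowMax σ₂ x y ∧ rowMax σ₂ x y ≤ R * rowMax σ₁ x y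

lemma emb_ne_zero (σ : F →+* ℝ) {x : 𝓞 F} (hx : x ≠ 0) : emb F σ x ≠ 0 := by
  simpa [emb] using hx

lemma rowMax_pos (σ : F →+* ℝ) {x y : 𝓞 F} (h : x ≠ 0 ∨ y ≠ 0) : 0 < rowMax σ x y := by
  rcases h with h | h
  · exact lt_max_of_lt_left (abs_pos.2 (emb_ne_zero σ h))
  · exact lt_max_of_lt_right (abs_pos.2 (emb_ne_zero σ h))

lemma rowMax_mul (σ : F →+* ℝ) (u x y : 𝓞 F) :
    rowMax σ (u * x) (u * y) = |emb F σ u| * rowMax σ x y := by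
  simp only [rowMax, map_mul, abs_mul]
  rw [mul_max_of_nonneg _ _ (abs_nonneg _)]

lemma exists_balanced (hd : Module.finrank ℚ F = 2) (h : σ₁ ≠ σ₂) :
    ∃ R : ℝ, 1 ≤ R ∧ ∀ x y : 𝓞 F, (x ≠ 0 ∨ y ≠ 0) →
      ∃ u : (𝓞 F)ˣ, TotPos F σ₁ σ₂ (u : 𝓞 F) ∧ Balanced σ₁ σ₂ R (u * x) (u * y) := by
  obtain ⟨ε, hε, hε1⟩ := exists_totPos_unit hd h
  have hzpow : ∀ n : ℤ, emb F σ₁ ((ε ^ n : (𝓞 F)ˣ) : 𝓞 F) = emb F σ₁ (ε : 𝓞 F) ^ n := fun n ↦ by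
    have := congrArg Units.val (map_zpow (Units.map (emb F σ₁ : 𝓞 F →* ℝ)) ε n)
    rw [Units.val_zpow_eq_zpow_val] at this
    exact this
  set e := emb F σ₁ (ε : 𝓞 F) with he
  refine ⟨e ^ 2, by nlinarith, fun x y hxy ↦ ?_⟩
  have h1 := rowMax_pos σ₁ hxy
  have h2 := rowMax_pos σ₂ hxy
  obtain ⟨n, hn1, hn2⟩ := exists_mem_Ico_zpow (div_pos h1 h2) (show 1 < e ^ 2 by nlinarith)
  refine ⟨ε ^ (-n), hε.zpow _, ?_⟩
  have hu := hε.zpow (-n)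
  have hm := hu.unit_mul hd h
  have hu1 : 0 < emb F σ₁ ((ε ^ (-n) : (𝓞 F)ˣ) : 𝓞 F) := hu.1
  have hu2 : 0 < emb F σ₂ ((ε ^ (-n) : (𝓞 F)ˣ) : 𝓞 F) := hu.2
  have hsq : (emb F σ₁ ((ε ^ (-n) : (𝓞 F)ˣ) : 𝓞 F)) ^ 2 * (e ^ 2) ^ n = 1 := by
    have he0 : e ≠ 0 := by linarith
    rw [hzpow, zpow_neg, inv_pow, ← zpow_natCast, ← zpow_natCast e 2, ← zpow_mul, ← zpow_mul,
      mul_comm n]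
    exact inv_mul_cancel₀ (zpow_ne_zero _ he0)
  rw [le_div_iff₀ h2] at hn1
  rw [div_lt_iff₀ h2] at hn2
  unfold Balanced
  rw [rowMax_mul, rowMax_mul, abs_of_pos hu1, abs_of_pos hu2]
  rw [zpow_add_one₀ (by positivity)] at hn2
  have hyn : 0 < (e ^ 2) ^ n := by
    have : 0 < e := by linarith
    positivity
  generalize emb F σ₁ ((ε ^ (-n) : (𝓞 F)ˣ) : 𝓞 F) = p at *
  generalize emb F σ₂ ((ε ^ (-n) : (𝓞 F)ˣ) : 𝓞 F) = q at *
  generalize rowMax σ₁ x y = A at *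
  generalize rowMax σ₂ x y = B at *
  generalize (e ^ 2) ^ n = Y at *
  have hq : q = p * Y := by
    have : p * q = p * (p * Y) := by rw [hm, ← hsq]; ring
    exact mul_left_cancel₀ hu1.ne' this
  subst hq
  constructor
  · have := mul_le_mul_of_nonneg_left hn2.le hu1.le
    nlinarith
  · have h3 := mul_le_mul_of_nonneg_left hn1 hu1.le
    have h4 : 0 ≤ p * A := by positivity
    nlinarith

lemma rowMax_rpow_le (hd : Module.finrank ℚ F = 2) (h : σ₁ ≠ σ₂) {R : ℝ} (hR : 1 ≤ R)
    {x y : 𝓞 F} (hxy : x ≠ 0 ∨ y ≠ 0) (hb : Balanced σ₁ σ₂ R x y) {α : ℝ} (hα : 0 ≤ α) :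
    (rowMax σ₁ x y * rowMax σ₂ x y) ^ (-α) ≤
      R ^ α * ((max 1 (supEmb σ₁ σ₂ x)) ^ (-α) * (max 1 (supEmb σ₁ σ₂ y)) ^ (-α)) := by
  have h1 := rowMax_pos σ₁ hxy
  have h2 := rowMax_pos σ₂ hxy
  have hx : supEmb σ₁ σ₂ x ≤ max (rowMax σ₁ x y) (rowMax σ₂ x y) :=
    max_le_max (le_max_left _ _) (le_max_left _ _)
  have hy : supEmb σ₁ σ₂ y ≤ max (rowMax σ₁ x y) (rowMax σ₂ x y) :=
    max_le_max (le_max_right _ _) (le_max_right _ _)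
  have hone : ∀ t : 𝓞 F, t ≠ 0 → 1 ≤ supEmb σ₁ σ₂ t := fun t ht ↦ by
    by_contra! hc
    have hc1 := (le_max_left _ _).trans_lt hc
    have hc2 := (le_max_right _ _).trans_lt hc
    have := one_le_abs_mul hd h ht
    have h0 := abs_nonneg (emb F σ₁ t)
    have h0' := abs_nonneg (emb F σ₂ t)
    nlinarith
  have h3 : 1 ≤ max (rowMax σ₁ x y) (rowMax σ₂ x y) := by
    rcases hxy with h | h
    · exact (hone _ h).trans hx
    · exact (hone _ h).trans hy
  have hsq : (max (rowMax σ₁ x y) (rowMax σ₂ x y)) ^ 2 ≤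
      R * (rowMax σ₁ x y * rowMax σ₂ x y) := by
    rcases max_cases (rowMax σ₁ x y) (rowMax σ₂ x y) with ⟨e, -⟩ | ⟨e, -⟩ <;> rw [e]
    · nlinarith [mul_le_mul_of_nonneg_left hb.1 h1.le]
    · nlinarith [mul_le_mul_of_nonneg_left hb.2 h2.le]
  have hX := max_le h3 hx
  have hY := max_le h3 hy
  set X := max 1 (supEmb σ₁ σ₂ x)
  set Y := max 1 (supEmb σ₁ σ₂ y)
  have hX1 : 1 ≤ X := le_max_left _ _
  have hY1 : 1 ≤ Y := le_max_left _ _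
  have hXY : X * Y ≤ R * (rowMax σ₁ x y * rowMax σ₂ x y) := by
    refine le_trans ?_ hsq
    rw [sq]
    exact mul_le_mul hX hY (by linarith) (by linarith)
  have hR0 : 0 < R := by linarith
  have h5 : R⁻¹ * (X * Y) ≤ rowMax σ₁ x y * rowMax σ₂ x y := by
    rw [inv_mul_eq_div, div_le_iff₀ hR0]
    linarith
  refine (Real.rpow_le_rpow_of_nonpos (by positivity) h5 (by linarith)).trans (le_of_eq ?_)
  rw [Real.mul_rpow (by positivity) (by positivity), Real.mul_rpow (by positivity) (by positivity),
    Real.inv_rpow hR0.le, Real.rpow_neg hR0.le, inv_inv]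

end Bounds

section Scaling

variable {F} {σ₁ σ₂ : F →+* ℝ}

open NumberField

lemma ofReal_mul_cpow {r : ℝ} (hr : 0 < r) (x e : ℂ) :
    ((r : ℂ) * x) ^ e = (r : ℂ) ^ e * x ^ e := by
  rcases eq_or_ne x 0 with rfl | hx
  · rcases eq_or_ne e 0 with rfl | he
    · simp
    · simp [he]
  · have hr' : (r : ℂ) ≠ 0 := by exact_mod_cast hr.ne'
    rw [Complex.cpow_def_of_ne_zero (mul_ne_zero hr' hx), Complex.cpow_def_of_ne_zero hr',
      Complex.cpow_def_of_ne_zero hx, Complex.log_ofReal_mul hr hx, ← Complex.exp_add,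
      Complex.ofReal_log hr.le]
    ring_nf

lemma place_scale {u v : ℝ} (hu : 0 < u) (hv : 0 < v) (D x q s w : ℂ) (k : ℕ) :
    ((u : ℂ) * (v * D)) ^ (w - 1) * ((u : ℂ) / v * x) ^ (-s) * ((v : ℂ) * q) ^ (-(k : ℤ)) =
      (u : ℂ) ^ (w - 1 - s) * (v : ℂ) ^ (w - 1 + s - k) *
        (D ^ (w - 1) * x ^ (-s) * q ^ (-(k : ℤ))) := by
  have hu' : (u : ℂ) ≠ 0 := by exact_mod_cast hu.ne'
  have hv' : (v : ℂ) ≠ 0 := by exact_mod_cast hv.ne'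
  have h1 : ((v⁻¹ : ℝ) : ℂ) ^ (-s) = (v : ℂ) ^ s := by
    rw [Complex.ofReal_inv, Complex.inv_cpow _ _ (by rw [Complex.arg_ofReal_of_nonneg hv.le]; exact
      Real.pi_pos.ne), Complex.cpow_neg, inv_inv]
  rw [show (u : ℂ) / v * x = (u : ℂ) * (((v⁻¹ : ℝ) : ℂ) * x) by push_cast; ring,
    ofReal_mul_cpow hu, ofReal_mul_cpow hv, ofReal_mul_cpow hu, ofReal_mul_cpow (inv_pos.2 hv),
    h1, mul_zpow, sub_eq_add_neg (w - 1) s, Complex.cpow_add _ _ hu', sub_eq_add_neg (w - 1 + s),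
    Complex.cpow_add _ _ hv', Complex.cpow_add _ _ hv']
  have h2 : (v : ℂ) ^ (-(k : ℂ)) = (v : ℂ) ^ (-(k : ℤ)) := by
    rw [← Complex.cpow_intCast]
    push_cast
    rfl
  rw [h2]
  ring

/-- Scaling the rows of a matrix by totally positive `u`, `v` scales the summand by powers of
the norms of `u` and `v`. -/
lemma mplusSummand_scale (k : ℕ) (s w z₁ z₂ : ℂ) {u v : 𝓞 F} (hu : TotPos F σ₁ σ₂ u)
    (hv : TotPos F σ₁ σ₂ v) (m : Matrix (Fin 2) (Fin 2) (𝓞 F)) :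
    mplusSummand F σ₁ σ₂ k s w z₁ z₂ (!![u, 0; 0, v] * m) =
      ((emb F σ₁ u * emb F σ₂ u : ℝ) : ℂ) ^ (w - 1 - s) *
        (((emb F σ₁ v * emb F σ₂ v : ℝ) : ℂ) ^ (w - 1 + s - k) *
          mplusSummand F σ₁ σ₂ k s w z₁ z₂ m) := by
  have hu1 : 0 < emb F σ₁ u := hu.1
  have hu2 : 0 < emb F σ₂ u := hu.2
  have hv1 : 0 < emb F σ₁ v := hv.1
  have hv2 : 0 < emb F σ₂ v := hv.2
  have hdet : ∀ σ : F →+* ℝ, ((emb F σ (!![u, 0; 0, v] * m).det : ℝ) : ℂ) =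
      (emb F σ u : ℂ) * ((emb F σ v : ℂ) * (emb F σ m.det : ℂ)) := fun σ ↦ by
    rw [Matrix.det_mul, Matrix.det_fin_two_of]
    simp only [mul_zero, sub_zero, map_mul, Complex.ofReal_mul]
    ring
  have hmoeb : ∀ (σ : F →+* ℝ) (z : ℂ), moebius ((!![u, 0; 0, v] * m).map (emb F σ)) z =
      (emb F σ u : ℂ) / (emb F σ v : ℂ) * moebius (m.map (emb F σ)) z := fun σ z ↦ by
    simp only [moebius, Matrix.map_apply, Matrix.mul_apply, Fin.sum_univ_two]
    simp only [Matrix.of_apply, Matrix.cons_val', Matrix.cons_val_zero, Matrix.cons_val_one,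
      Matrix.cons_val_fin_one, zero_mul, add_zero, zero_add, map_mul, Complex.ofReal_mul]
    rw [div_mul_div_comm]
    congr 1 <;> ring
  have hj : ∀ (σ : F →+* ℝ) (z : ℂ), jfac ((!![u, 0; 0, v] * m).map (emb F σ)) z =
      (emb F σ v : ℂ) * jfac (m.map (emb F σ)) z := fun σ z ↦ by
    simp only [jfac, Matrix.map_apply, Matrix.mul_apply, Fin.sum_univ_two]
    simp only [Matrix.of_apply, Matrix.cons_val', Matrix.cons_val_zero, Matrix.cons_val_one,
      Matrix.cons_val_fin_one, zero_mul, zero_add, map_mul, Complex.ofReal_mul]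
    ring
  have e1 := place_scale hu1 hv1 (emb F σ₁ m.det : ℂ) (moebius (m.map (emb F σ₁)) z₁)
    (jfac (m.map (emb F σ₁)) z₁) s w k
  have e2 := place_scale hu2 hv2 (emb F σ₂ m.det : ℂ) (moebius (m.map (emb F σ₂)) z₂)
    (jfac (m.map (emb F σ₂)) z₂) s w k
  unfold mplusSummand
  rw [hdet, hdet, hmoeb, hmoeb, hj, hj, Complex.ofReal_mul (emb F σ₁ u),
    Complex.ofReal_mul (emb F σ₁ v), ofReal_mul_cpow hu1 _ (w - 1 - s),
    ofReal_mul_cpow hv1 _ (w - 1 + s - k)]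
  linear_combination (((emb F σ₂ u : ℂ) * ((emb F σ₂ v : ℂ) * (emb F σ₂ m.det : ℂ))) ^ (w - 1) *
    ((emb F σ₂ u : ℂ) / (emb F σ₂ v : ℂ) * moebius (m.map (emb F σ₂)) z₂) ^ (-s) *
    ((emb F σ₂ v : ℂ) * jfac (m.map (emb F σ₂)) z₂) ^ (-(k : ℤ))) * e1 +
    ((emb F σ₁ u : ℂ) ^ (w - 1 - s) * (emb F σ₁ v : ℂ) ^ (w - 1 + s - k) *
        ((emb F σ₁ m.det : ℂ) ^ (w - 1) * moebius (m.map (emb F σ₁)) z₁ ^ (-s) *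
          jfac (m.map (emb F σ₁)) z₁ ^ (-(k : ℤ)))) * e2

lemma atildeRel_summand (hd : Module.finrank ℚ F = 2) (h : σ₁ ≠ σ₂) (k : ℕ) (s w z₁ z₂ : ℂ)
    {m m' : Mplus F σ₁ σ₂} (hr : AtildeRel F σ₁ σ₂ m m') :
    mplusSummand F σ₁ σ₂ k s w z₁ z₂ m.1 = mplusSummand F σ₁ σ₂ k s w z₁ z₂ m'.1 := by
  obtain ⟨u, v, hu, hv, e⟩ := hr
  rw [e, mplusSummand_scale k s w z₁ z₂ hu hv, hu.unit_mul hd h,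
    hv.unit_mul hd h]
  simp

end Scaling

section Summability

variable {F} {σ₁ σ₂ : F →+* ℝ}

open NumberField

lemma real_bound {ρ σ κ y₁ y₂ K₁ K₂ : ℝ} (hy₁ : 0 < y₁) (hy₂ : 0 < y₂) (hK₁ : 0 < K₁)
    (hK₂ : 0 < K₂) (hα : 0 ≤ σ - max ρ 0) (hβ : 0 ≤ κ - σ - max ρ 0) :
    ∃ C : ℝ, 0 ≤ C ∧ ∀ P₁ P₂ Q₁ Q₂ D₁ D₂ M₁ M₂ N₁ N₂ : ℝ, 0 < P₁ → 0 < P₂ → 0 < Q₁ → 0 < Q₂ →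
      0 < D₁ → 0 < D₂ → 0 < M₁ → 0 < M₂ → 0 < N₁ → 0 < N₂ → 1 ≤ D₁ * D₂ →
      D₁ * y₁ ≤ P₁ * Q₁ → D₂ * y₂ ≤ P₂ * Q₂ → M₁ ≤ K₁ * P₁ → M₂ ≤ K₂ * P₂ →
      N₁ ≤ K₁ * Q₁ → N₂ ≤ K₂ * Q₂ →
      D₁ ^ ρ * D₂ ^ ρ * ((P₁ / Q₁) ^ (-σ) * (P₂ / Q₂) ^ (-σ)) * (Q₁ ^ (-κ) * Q₂ ^ (-κ)) ≤
        C * ((M₁ * M₂) ^ (-(σ - max ρ 0)) * (N₁ * N₂) ^ (-(κ - σ - max ρ 0))) := by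
  set r := max ρ 0 with hr
  have hr0 : 0 ≤ r := le_max_right _ _
  refine ⟨(y₁ * y₂) ^ (-r) * (K₁ * K₂) ^ (σ - r) * (K₁ * K₂) ^ (κ - σ - r), by positivity, ?_⟩
  intro P₁ P₂ Q₁ Q₂ D₁ D₂ M₁ M₂ N₁ N₂ hP₁ hP₂ hQ₁ hQ₂ hD₁ hD₂ hM₁ hM₂ hN₁ hN₂ hD hDy₁ hDy₂
    hMP₁ hMP₂ hNQ₁ hNQ₂
  have hP : 0 < P₁ * P₂ := by positivity
  have hQ : 0 < Q₁ * Q₂ := by positivity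
  have hy : 0 < y₁ * y₂ := by positivity
  have hK : 0 < K₁ * K₂ := by positivity
  have hrow : ∀ {A₁ A₂ B₁ B₂ e : ℝ}, 0 < A₁ → 0 < A₂ → 0 < B₁ → 0 < B₂ → A₁ ≤ K₁ * B₁ →
      A₂ ≤ K₂ * B₂ → 0 ≤ e → (B₁ * B₂) ^ (-e) ≤ (K₁ * K₂) ^ e * (A₁ * A₂) ^ (-e) := by
    intro A₁ A₂ B₁ B₂ e hA₁ hA₂ hB₁ hB₂ h₁ h₂ he
    have h3 : (K₁ * K₂)⁻¹ * (A₁ * A₂) ≤ B₁ * B₂ := by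
      rw [inv_mul_eq_div, div_le_iff₀ hK]
      calc A₁ * A₂ ≤ (K₁ * B₁) * (K₂ * B₂) := mul_le_mul h₁ h₂ hA₂.le (by positivity)
        _ = _ := by ring
    refine (Real.rpow_le_rpow_of_nonpos (by positivity) h3 (by linarith)).trans (le_of_eq ?_)
    rw [Real.mul_rpow (by positivity) (by positivity), Real.inv_rpow hK.le, Real.rpow_neg hK.le,
      inv_inv]
  have hDr : (D₁ * D₂) ^ ρ ≤ (y₁ * y₂) ^ (-r) * ((P₁ * P₂) ^ r * (Q₁ * Q₂) ^ r) := by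
    refine (Real.rpow_le_rpow_of_exponent_le hD (le_max_left ρ 0)).trans ?_
    have h4 : D₁ * D₂ ≤ (y₁ * y₂)⁻¹ * ((P₁ * P₂) * (Q₁ * Q₂)) := by
      rw [inv_mul_eq_div, le_div_iff₀ hy]
      calc D₁ * D₂ * (y₁ * y₂) = (D₁ * y₁) * (D₂ * y₂) := by ring
        _ ≤ (P₁ * Q₁) * (P₂ * Q₂) := mul_le_mul hDy₁ hDy₂ (by positivity) (by positivity)
        _ = _ := by ring
    refine (Real.rpow_le_rpow (by positivity) h4 hr0).trans (le_of_eq ?_)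
    rw [Real.mul_rpow (by positivity) (by positivity), Real.mul_rpow (by positivity)
      (by positivity), Real.inv_rpow hy.le, Real.rpow_neg hy.le]
  rw [← Real.mul_rpow hD₁.le hD₂.le, ← Real.mul_rpow (by positivity) (by positivity),
    ← Real.mul_rpow hQ₁.le hQ₂.le, div_mul_div_comm, Real.div_rpow hP.le hQ.le]
  have hPM := hrow hM₁ hM₂ hP₁ hP₂ hMP₁ hMP₂ hα
  have hQN := hrow hN₁ hN₂ hQ₁ hQ₂ hNQ₁ hNQ₂ hβ
  calc _ ≤ ((y₁ * y₂) ^ (-r) * ((P₁ * P₂) ^ r * (Q₁ * Q₂) ^ r)) *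
        ((P₁ * P₂) ^ (-σ) / (Q₁ * Q₂) ^ (-σ)) * (Q₁ * Q₂) ^ (-κ) := by gcongr
    _ = (y₁ * y₂) ^ (-r) * ((P₁ * P₂) ^ (-(σ - r)) * (Q₁ * Q₂) ^ (-(κ - σ - r))) := by
      rw [show -(σ - r) = r + -σ by ring, show -(κ - σ - r) = r - -σ + -κ by ring,
        Real.rpow_add hP, Real.rpow_add hQ, Real.rpow_sub hQ]
      ring
    _ ≤ (y₁ * y₂) ^ (-r) * (((K₁ * K₂) ^ (σ - r) * (M₁ * M₂) ^ (-(σ - r))) *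
        ((K₁ * K₂) ^ (κ - σ - r) * (N₁ * N₂) ^ (-(κ - σ - r)))) := by gcongr
    _ = _ := by ring

lemma linear_ne_zero {z : ℂ} (hz : 0 < z.im) {a b : ℝ} (h : a ≠ 0 ∨ b ≠ 0) :
    (a : ℂ) * z + b ≠ 0 := by
  obtain ⟨K, -, hK⟩ := exists_max_abs_le hz
  intro e
  have h1 := hK a b
  rw [e, norm_zero, mul_zero] at h1
  rcases h with h | h
  · exact absurd (abs_pos.2 h) (not_lt.2 ((le_max_left _ _).trans h1))
  · exact absurd (abs_pos.2 h) (not_lt.2 ((le_max_right _ _).trans h1))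

lemma Mplus.row_ne_zero (m : Mplus F σ₁ σ₂) (i : Fin 2) : m.1 i 0 ≠ 0 ∨ m.1 i 1 ≠ 0 := by
  by_contra! hc
  apply TotPos.ne_zero m.2
  rw [Matrix.det_fin_two]
  fin_cases i <;> simp_all

lemma exists_norm_summand_le (hd : Module.finrank ℚ F = 2) (h : σ₁ ≠ σ₂) (k : ℕ) (s w : ℂ)
    {z₁ z₂ : ℂ} (hz₁ : 0 < z₁.im) (hz₂ : 0 < z₂.im) (hα : 0 ≤ s.re - max (w.re - 1) 0)
    (hβ : 0 ≤ k - s.re - max (w.re - 1) 0) :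
    ∃ C : ℝ, 0 ≤ C ∧ ∀ m : Mplus F σ₁ σ₂, ‖mplusSummand F σ₁ σ₂ k s w z₁ z₂ m.1‖ ≤
      C * ((rowMax σ₁ (m.1 0 0) (m.1 0 1) * rowMax σ₂ (m.1 0 0) (m.1 0 1)) ^
          (-(s.re - max (w.re - 1) 0)) *
        (rowMax σ₁ (m.1 1 0) (m.1 1 1) * rowMax σ₂ (m.1 1 0) (m.1 1 1)) ^
          (-(k - s.re - max (w.re - 1) 0))) := by
  obtain ⟨K₁, hK₁, hb₁⟩ := exists_max_abs_le hz₁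
  obtain ⟨K₂, hK₂, hb₂⟩ := exists_max_abs_le hz₂
  obtain ⟨C, hC, hreal⟩ := real_bound hz₁ hz₂ hK₁ hK₂ hα hβ
  set c := Real.exp (Real.pi * |s.im|)
  refine ⟨c * c * C, by positivity, fun m ↦ ?_⟩
  have hne : ∀ (σ : F →+* ℝ) {z : ℂ}, 0 < z.im → ∀ i,
      0 < ‖((emb F σ (m.1 i 0) : ℝ) : ℂ) * z + (emb F σ (m.1 i 1) : ℝ)‖ := fun σ z hz i ↦
    norm_pos_iff.2 (linear_ne_zero hz ((m.row_ne_zero i).imp (emb_ne_zero σ) (emb_ne_zero σ)))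
  have hdet : ∀ σ : F →+* ℝ, emb F σ m.1.det = emb F σ (m.1 0 0) * emb F σ (m.1 1 1) -
      emb F σ (m.1 0 1) * emb F σ (m.1 1 0) := fun σ ↦ by
    rw [Matrix.det_fin_two, map_sub, map_mul, map_mul]
  have hD₁ : 0 < emb F σ₁ m.1.det := m.2.1
  have hD₂ : 0 < emb F σ₂ m.1.det := m.2.2
  have hD : 1 ≤ emb F σ₁ m.1.det * emb F σ₂ m.1.det := by
    have := one_le_abs_mul hd h (TotPos.ne_zero m.2)
    rwa [abs_of_pos hD₁, abs_of_pos hD₂] at this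
  have key := hreal _ _ _ _ _ _ _ _ _ _ (hne σ₁ hz₁ 0) (hne σ₂ hz₂ 0) (hne σ₁ hz₁ 1)
    (hne σ₂ hz₂ 1) hD₁ hD₂ (rowMax_pos σ₁ (m.row_ne_zero 0)) (rowMax_pos σ₂ (m.row_ne_zero 0))
    (rowMax_pos σ₁ (m.row_ne_zero 1)) (rowMax_pos σ₂ (m.row_ne_zero 1)) hD
    (by rw [hdet]; exact det_mul_im_le z₁ _ _ _ _) (by rw [hdet]; exact det_mul_im_le z₂ _ _ _ _)
    (hb₁ _ _) (hb₂ _ _) (hb₁ _ _) (hb₂ _ _)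
  rw [mul_assoc (c * c)]
  refine le_trans ?_ (mul_le_mul_of_nonneg_left key (by positivity))
  unfold mplusSummand
  simp only [norm_mul]
  rw [Complex.norm_cpow_eq_rpow_re_of_pos hD₁, Complex.norm_cpow_eq_rpow_re_of_pos hD₂]
  have e1 := norm_cpow_neg_le (moebius (m.1.map (emb F σ₁)) z₁) s
  have e2 := norm_cpow_neg_le (moebius (m.1.map (emb F σ₂)) z₂) s
  have e3 : ∀ x : ℂ, ‖x ^ (-(k : ℤ))‖ = ‖x‖ ^ (-(k : ℝ)) := fun x ↦ by
    rw [norm_zpow, ← Real.rpow_intCast]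
    push_cast
    rfl
  rw [e3, e3]
  have e4 : ∀ (σ : F →+* ℝ) (z : ℂ), ‖moebius (m.1.map (emb F σ)) z‖ =
      ‖((emb F σ (m.1 0 0) : ℝ) : ℂ) * z + (emb F σ (m.1 0 1) : ℝ)‖ /
      ‖((emb F σ (m.1 1 0) : ℝ) : ℂ) * z + (emb F σ (m.1 1 1) : ℝ)‖ := fun σ z ↦ by
    simp only [moebius, Matrix.map_apply, norm_div]
  rw [e4] at e1 e2
  simp only [jfac, Matrix.map_apply, Complex.sub_re, Complex.one_re]
  refine (mul_le_mul_of_nonneg_right (mul_le_mul_of_nonneg_left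
    (mul_le_mul e1 e2 (norm_nonneg _) (by positivity)) (by positivity))
    (by positivity)).trans (le_of_eq ?_)
  ring

lemma summable_of_summand (hd : Module.finrank ℚ F = 2) (h : σ₁ ≠ σ₂) (k : ℕ) (s w : ℂ)
    {z₁ z₂ : ℂ} (hz₁ : 0 < z₁.im) (hz₂ : 0 < z₂.im) (hα : 2 < s.re - max (w.re - 1) 0)
    (hβ : 2 < k - s.re - max (w.re - 1) 0) (g : Quot (AtildeRel F σ₁ σ₂) → ℂ)
    (hg : ∀ m : Mplus F σ₁ σ₂, g (Quot.mk _ m) = mplusSummand F σ₁ σ₂ k s w z₁ z₂ m.1) :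
    Summable g := by
  obtain ⟨C, hC, hbound⟩ := exists_norm_summand_le (σ₁ := σ₁) (σ₂ := σ₂) hd h k s w hz₁ hz₂
    (by linarith) (by linarith)
  obtain ⟨R, hR, hbal⟩ := exists_balanced hd h
  set α := s.re - max (w.re - 1) 0
  set β := k - s.re - max (w.re - 1) 0
  have hrep : ∀ q : Quot (AtildeRel F σ₁ σ₂), ∃ m : Mplus F σ₁ σ₂, Quot.mk _ m = q ∧
      Balanced σ₁ σ₂ R (m.1 0 0) (m.1 0 1) ∧ Balanced σ₁ σ₂ R (m.1 1 0) (m.1 1 1) := by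
    intro q
    induction q using Quot.ind with
    | mk m =>
      obtain ⟨u, hu, hub⟩ := hbal _ _ (m.row_ne_zero 0)
      obtain ⟨v, hv, hvb⟩ := hbal _ _ (m.row_ne_zero 1)
      refine ⟨⟨!![(u : 𝓞 F), 0; 0, (v : 𝓞 F)] * m.1, ?_⟩, (Quot.sound ?_).symm, ?_, ?_⟩
      · rw [Matrix.det_mul, Matrix.det_fin_two_of, mul_zero, sub_zero]
        exact (hu.mul hv).mul m.2
      · exact ⟨u, v, hu, hv, rfl⟩
      · simpa [Matrix.mul_apply, Fin.sum_univ_two] using hub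
      · simpa [Matrix.mul_apply, Fin.sum_univ_two] using hvb
  choose rep hmk hb0 hb1 using hrep
  let Φ : Quot (AtildeRel F σ₁ σ₂) → (𝓞 F × 𝓞 F) × (𝓞 F × 𝓞 F) := fun q ↦
    (((rep q).1 0 0, (rep q).1 0 1), ((rep q).1 1 0, (rep q).1 1 1))
  have hΦ : Function.Injective Φ := by
    intro q q' e
    simp only [Φ, Prod.mk.injEq] at e
    have hm : rep q = rep q' := by
      ext i j
      fin_cases i <;> fin_cases j <;> simp [e]
    rw [← hmk q, ← hmk q', hm]
  have hpair : ∀ {e : ℝ}, 2 < e → Summable fun p : 𝓞 F × 𝓞 F ↦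
      (max 1 (supEmb σ₁ σ₂ p.1)) ^ (-e) * (max 1 (supEmb σ₁ σ₂ p.2)) ^ (-e) := fun he ↦
    (summable_supEmb_rpow hd h he).mul_of_nonneg (summable_supEmb_rpow hd h he)
      (fun _ ↦ by positivity) (fun _ ↦ by positivity)
  have hsum := (((hpair hα).mul_of_nonneg (hpair hβ) (fun _ ↦ by positivity)
    (fun _ ↦ by positivity)).comp_injective hΦ).mul_left (C * (R ^ α * R ^ β))
  refine Summable.of_norm_bounded hsum fun q ↦ ?_
  have h1 := hbound (rep q)
  rw [← hg, hmk] at h1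
  refine h1.trans ?_
  have r0 := rowMax_rpow_le hd h hR ((rep q).row_ne_zero 0) (hb0 q) (show 0 ≤ α by linarith)
  have r1 := rowMax_rpow_le hd h hR ((rep q).row_ne_zero 1) (hb1 q) (show 0 ≤ β by linarith)
  have p1 := rowMax_pos σ₁ ((rep q).row_ne_zero 1)
  have p2 := rowMax_pos σ₂ ((rep q).row_ne_zero 1)
  refine (mul_le_mul_of_nonneg_left (mul_le_mul r0 r1 (by positivity) (by positivity))
    hC).trans (le_of_eq ?_)
  simp only [Φ, Function.comp]
  ring

end Summability

section Unfolding

variable {F} {σ₁ σ₂ : F →+* ℝ}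

open NumberField

lemma gammaInfRel_iff {γ γ' : SL2O F} :
    GammaInfRel F σ₁ σ₂ γ γ' ↔ ∃ η : (𝓞 F)ˣ, TotPos F σ₁ σ₂ (η : 𝓞 F) ∧
      ∀ j, γ'.1 1 j = η * γ.1 1 j := by
  constructor
  · rintro ⟨p, ⟨h10, h00, h11⟩, rfl⟩
    have hdet := p.det_coe
    rw [Matrix.det_fin_two, h10, mul_zero, sub_zero] at hdet
    refine ⟨⟨p.1 1 1, p.1 0 0, by rw [mul_comm]; exact hdet, hdet⟩, h11, fun j ↦ ?_⟩
    change (p.1 * γ.1) 1 j = p.1 1 1 * γ.1 1 j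
    have h10' : p.1 1 0 = 0 := h10
    rw [Matrix.mul_apply, Fin.sum_univ_two, h10', zero_mul, zero_add]
  · rintro ⟨η, hη, hrow⟩
    have hdet := γ.det_coe
    rw [Matrix.det_fin_two] at hdet
    have hmul : ∀ i j, (γ' * γ⁻¹ : SL2O F).1 i j =
        γ'.1 i 0 * (γ.1.adjugate) 0 j + γ'.1 i 1 * (γ.1.adjugate) 1 j := fun i j ↦ by
      rw [Matrix.SpecialLinearGroup.coe_mul, Matrix.SpecialLinearGroup.coe_inv, Matrix.mul_apply,
        Fin.sum_univ_two]
    have h10 : (γ' * γ⁻¹ : SL2O F).1 1 0 = 0 := by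
      rw [hmul, Matrix.adjugate_fin_two, hrow, hrow]
      simp
      ring
    have h11 : (γ' * γ⁻¹ : SL2O F).1 1 1 = η := by
      rw [hmul, Matrix.adjugate_fin_two, hrow, hrow]
      simp
      linear_combination (η : 𝓞 F) * hdet
    have hp := (γ' * γ⁻¹ : SL2O F).det_coe
    rw [Matrix.det_fin_two, h10, h11, mul_zero, sub_zero] at hp
    refine ⟨γ' * γ⁻¹, ⟨h10, ?_, ?_⟩, by simp⟩
    · refine TotPos.of_mul hη ?_
      rw [mul_comm, hp]
      exact totPos_one
    · rw [h11]
      exact hη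

lemma pairRel_equivalence : Equivalence (PairRel F σ₁ σ₂) := by
  have hrefl : ∀ γ, GammaInfRel F σ₁ σ₂ γ γ := fun γ ↦
    gammaInfRel_iff.2 ⟨1, totPos_one, fun j ↦ by simp⟩
  have hsymm : ∀ {γ γ'}, GammaInfRel F σ₁ σ₂ γ γ' → GammaInfRel F σ₁ σ₂ γ' γ := fun h ↦ by
    obtain ⟨η, hη, h⟩ := gammaInfRel_iff.1 h
    exact gammaInfRel_iff.2 ⟨η⁻¹, hη.inv, fun j ↦ by rw [h, Units.inv_mul_cancel_left]⟩
  have htrans : ∀ {γ γ' γ''}, GammaInfRel F σ₁ σ₂ γ γ' → GammaInfRel F σ₁ σ₂ γ' γ'' →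
      GammaInfRel F σ₁ σ₂ γ γ'' := fun h h' ↦ by
    obtain ⟨η, hη, h⟩ := gammaInfRel_iff.1 h
    obtain ⟨η', hη', h'⟩ := gammaInfRel_iff.1 h'
    exact gammaInfRel_iff.2 ⟨η' * η, hη'.mul hη, fun j ↦ by rw [h', h, Units.val_mul, mul_assoc]⟩
  exact ⟨fun p ↦ ⟨hrefl _, hrefl _⟩, fun h ↦ ⟨hsymm h.1, hsymm h.2⟩,
    fun h h' ↦ ⟨htrans h.1 h'.1, htrans h.2 h'.2⟩⟩

lemma atildeRel_equivalence : Equivalence (AtildeRel F σ₁ σ₂) := by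
  refine ⟨fun m ↦ ⟨1, 1, totPos_one, totPos_one, ?_⟩, ?_, ?_⟩
  · rw [Units.val_one, ← Matrix.one_fin_two, one_mul]
  · rintro m m' ⟨u, v, hu, hv, e⟩
    refine ⟨u⁻¹, v⁻¹, hu.inv, hv.inv, ?_⟩
    rw [e, ← mul_assoc, Matrix.mul_fin_two]
    simp [← Matrix.one_fin_two]
  · rintro m m' m'' ⟨u, v, hu, hv, e⟩ ⟨u', v', hu', hv', e'⟩
    refine ⟨u' * u, v' * v, hu'.mul hu, hv'.mul hv, ?_⟩
    rw [e', e, ← mul_assoc, Matrix.mul_fin_two]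
    simp

lemma exists_row_factor (hF : RealQuadNarrowOne F σ₁ σ₂) {r : Fin 2 → 𝓞 F}
    (h : r 0 ≠ 0 ∨ r 1 ≠ 0) :
    ∃ (u : 𝓞 F) (γ : SL2O F), TotPos F σ₁ σ₂ u ∧ ∀ j, r j = u * γ.1 1 j := by
  obtain ⟨u, hu, hI⟩ := hF.2.2 (Ideal.span {r 0, r 1}) (by
    rw [Ne, Ideal.span_eq_bot]
    intro hc
    rcases h with h | h
    · exact h (hc _ (by simp))
    · exact h (hc _ (by simp)))
  have h0 : r 0 ∈ Ideal.span {u} := hI ▸ Ideal.subset_span (by simp)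
  have h1 : r 1 ∈ Ideal.span {u} := hI ▸ Ideal.subset_span (by simp)
  have hum : u ∈ Ideal.span {r 0, r 1} := hI ▸ Ideal.mem_span_singleton_self u
  obtain ⟨c, hc⟩ := Ideal.mem_span_singleton.1 h0
  obtain ⟨d, hd⟩ := Ideal.mem_span_singleton.1 h1
  obtain ⟨x, y, hxy⟩ := Ideal.mem_span_pair.1 hum
  have hdet : y * d + x * c = 1 := by
    apply mul_left_cancel₀ hu.ne_zero
    rw [hc, hd] at hxy
    linear_combination hxy
  refine ⟨u, ⟨!![y, -x; c, d], ?_⟩, hu, fun j ↦ ?_⟩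
  · rw [Matrix.det_fin_two_of, ← hdet]
    ring
  · fin_cases j
    · simpa using hc
    · simpa using hd

lemma row_factor_unique {u u' : 𝓞 F} (hu : TotPos F σ₁ σ₂ u) (hu' : TotPos F σ₁ σ₂ u')
    {γ γ' : SL2O F} (h : ∀ j, u * γ.1 1 j = u' * γ'.1 1 j) :
    Ideal.span {u} = Ideal.span {u'} ∧ GammaInfRel F σ₁ σ₂ γ γ' := by
  have hdvd : ∀ {u u' : 𝓞 F} {γ γ' : SL2O F}, (∀ j, u * γ.1 1 j = u' * γ'.1 1 j) → u' ∣ u := by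
    intro u u' γ γ' h
    have hdet := γ.det_coe
    rw [Matrix.det_fin_two] at hdet
    refine ⟨γ.1 0 0 * γ'.1 1 1 - γ.1 0 1 * γ'.1 1 0, ?_⟩
    linear_combination (-u) * hdet + γ.1 0 0 * h 1 - γ.1 0 1 * h 0
  obtain ⟨ε, hε⟩ := associated_of_dvd_dvd (hdvd h) (hdvd fun j ↦ (h j).symm)
  have hεp : TotPos F σ₁ σ₂ (ε : 𝓞 F) := hu'.of_mul (hε ▸ hu)
  refine ⟨Ideal.span_singleton_eq_span_singleton.2 ⟨ε⁻¹, by rw [← hε, Units.mul_inv_cancel_right]⟩,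
    gammaInfRel_iff.2 ⟨ε, hεp, fun j ↦ ?_⟩⟩
  apply mul_left_cancel₀ hu'.ne_zero
  rw [← h j, ← hε]
  ring

/-- The matrix whose rows are the lower rows of `γ` and `δ`. -/
def lowerRows (γ δ : SL2O F) : Matrix (Fin 2) (Fin 2) (𝓞 F) :=
  !![γ.1 1 0, γ.1 1 1; δ.1 1 0, δ.1 1 1]

lemma det_lowerRows (γ δ : SL2O F) : (lowerRows γ δ).det = lowc F γ δ := by
  rw [lowc, Matrix.SpecialLinearGroup.coe_mul, Matrix.SpecialLinearGroup.coe_inv,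
    Matrix.adjugate_fin_two, Matrix.mul_apply, Fin.sum_univ_two, lowerRows, Matrix.det_fin_two_of]
  simp
  ring

lemma mplusSummand_lowerRows (k : ℕ) (s w z₁ z₂ : ℂ) (γ δ : SL2O F) :
    mplusSummand F σ₁ σ₂ k s w z₁ z₂ (lowerRows γ δ) =
      dblSummand F σ₁ σ₂ k s w z₁ z₂ γ δ := by
  unfold mplusSummand dblSummand
  rw [det_lowerRows]
  rfl

lemma eq_diag_mul_lowerRows {m : Matrix (Fin 2) (Fin 2) (𝓞 F)} {u v : 𝓞 F} {γ δ : SL2O F}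
    (h0 : ∀ j, m 0 j = u * γ.1 1 j) (h1 : ∀ j, m 1 j = v * δ.1 1 j) :
    m = !![u, 0; 0, v] * lowerRows γ δ := by
  ext i j : 1
  fin_cases i <;> fin_cases j <;>
    simp [lowerRows, Matrix.mul_apply, Fin.sum_univ_two, h0, h1]

end Unfolding

section Main

variable {F} {σ₁ σ₂ : F →+* ℝ}

open NumberField

lemma absNorm_cpow (hd : Module.finrank ℚ F = 2) (h : σ₁ ≠ σ₂) {u : 𝓞 F}
    (hu : TotPos F σ₁ σ₂ u) (e : ℂ) :
    (Ideal.absNorm (Ideal.span {u}) : ℂ) ^ e = ((emb F σ₁ u * emb F σ₂ u : ℝ) : ℂ) ^ e := by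
  rw [← absNorm_span_eq hd h hu, Complex.ofReal_natCast]

lemma dblExt_of_totPos (k : ℕ) (s w z₁ z₂ : ℂ) {γ δ : SL2O F}
    (h : TotPos F σ₁ σ₂ (lowc F γ δ)) :
    dblExt F σ₁ σ₂ k s w z₁ z₂ γ δ = dblSummand F σ₁ σ₂ k s w z₁ z₂ γ δ := if_pos h

lemma totPos_diag_mul {u v : 𝓞 F} (hu : TotPos F σ₁ σ₂ u) (hv : TotPos F σ₁ σ₂ v)
    (m : Matrix (Fin 2) (Fin 2) (𝓞 F)) :
    TotPos F σ₁ σ₂ (!![u, 0; 0, v] * m).det ↔ TotPos F σ₁ σ₂ m.det := by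
  rw [Matrix.det_mul, Matrix.det_fin_two_of, mul_zero, sub_zero]
  exact ⟨(hu.mul hv).of_mul, (hu.mul hv).mul⟩

lemma tsum_eq_of_summable (hF : RealQuadNarrowOne F σ₁ σ₂) (k : ℕ) (s w z₁ z₂ : ℂ)
    (E : Quot (PairRel F σ₁ σ₂) → ℂ)
    (hE : ∀ p : SL2O F × SL2O F, E (Quot.mk _ p) = dblExt F σ₁ σ₂ k s w z₁ z₂ p.1 p.2)
    (g : Quot (AtildeRel F σ₁ σ₂) → ℂ)
    (hg : ∀ m : Mplus F σ₁ σ₂, g (Quot.mk _ m) = mplusSummand F σ₁ σ₂ k s w z₁ z₂ m.1)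
    (hs : Summable g) :
    zetaVal F (1 - w + s) * zetaVal F (1 - w + (k : ℂ) - s) * ∑' q, E q = ∑' q, g q := by
  obtain ⟨hd, h, -⟩ := id hF
  have hfac : ∀ q : Quot (AtildeRel F σ₁ σ₂), ∃ (u v : 𝓞 F) (γ δ : SL2O F),
      TotPos F σ₁ σ₂ u ∧ TotPos F σ₁ σ₂ v ∧ q.out.1 = !![u, 0; 0, v] * lowerRows γ δ := by
    intro q
    obtain ⟨u, γ, hu, h0⟩ := exists_row_factor hF (q.out.row_ne_zero 0)
    obtain ⟨v, δ, hv, h1⟩ := exists_row_factor hF (q.out.row_ne_zero 1)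
    exact ⟨u, v, γ, δ, hu, hv, eq_diag_mul_lowerRows h0 h1⟩
  choose u v γ δ hu hv hm using hfac
  let J := {I : Ideal (𝓞 F) // I ≠ ⊥}
  have hspan : ∀ {x : 𝓞 F}, TotPos F σ₁ σ₂ x → Ideal.span {x} ≠ ⊥ := fun hx ↦ by
    rw [Ne, Ideal.span_singleton_eq_bot]
    exact hx.ne_zero
  let Φ : Quot (AtildeRel F σ₁ σ₂) → J × J × Quot (PairRel F σ₁ σ₂) := fun q ↦
    (⟨Ideal.span {u q}, hspan (hu q)⟩, ⟨Ideal.span {v q}, hspan (hv q)⟩, Quot.mk _ (γ q, δ q))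
  let G : J × J × Quot (PairRel F σ₁ σ₂) → ℂ := fun t ↦
    (Ideal.absNorm t.1.1 : ℂ) ^ (-(1 - w + s)) *
      ((Ideal.absNorm t.2.1.1 : ℂ) ^ (-(1 - w + (k : ℂ) - s)) * E t.2.2)
  have hGΦ : ∀ q, G (Φ q) = g q := fun q ↦ by
    have hdet : TotPos F σ₁ σ₂ (lowc F (γ q) (δ q)) := by
      rw [← det_lowerRows, ← totPos_diag_mul (hu q) (hv q), ← hm]
      exact q.out.2
    conv_rhs => rw [← Quot.out_eq q]
    rw [hg, hm, mplusSummand_scale k s w z₁ z₂ (hu q) (hv q), mplusSummand_lowerRows]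
    simp only [G, Φ]
    rw [hE, dblExt_of_totPos k s w z₁ z₂ hdet, absNorm_cpow hd h (hu q),
      absNorm_cpow hd h (hv q), show -(1 - w + s) = w - 1 - s by ring,
      show -(1 - w + (k : ℂ) - s) = w - 1 + s - k by ring]
  have hrow0 : ∀ (u v : 𝓞 F) (γ δ : SL2O F) j,
      (!![u, 0; 0, v] * lowerRows γ δ) 0 j = u * γ.1 1 j := fun u v γ δ j ↦ by
    fin_cases j <;> simp [lowerRows, Matrix.mul_apply, Fin.sum_univ_two]
  have hrow1 : ∀ (u v : 𝓞 F) (γ δ : SL2O F) j,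
      (!![u, 0; 0, v] * lowerRows γ δ) 1 j = v * δ.1 1 j := fun u v γ δ j ↦ by
    fin_cases j <;> simp [lowerRows, Matrix.mul_apply, Fin.sum_univ_two]
  have hinj : Function.Injective Φ := by
    intro q q' e
    simp only [Φ, Prod.mk.injEq] at e
    obtain ⟨eu, ev, ep⟩ := e
    obtain ⟨e1, e2⟩ := (pairRel_equivalence.quot_mk_eq_iff _ _).1 ep
    obtain ⟨η, hη, e1⟩ := gammaInfRel_iff.1 e1
    obtain ⟨θ, hθ, e2⟩ := gammaInfRel_iff.1 e2
    dsimp only at e1 e2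
    obtain ⟨ε, hε⟩ := Ideal.span_singleton_eq_span_singleton.1 (Subtype.ext_iff.1 eu)
    obtain ⟨κ, hκ⟩ := Ideal.span_singleton_eq_span_singleton.1 (Subtype.ext_iff.1 ev)
    rw [← Quot.out_eq q, ← Quot.out_eq q']
    refine Quot.sound ⟨ε * η, κ * θ, ((hu q).of_mul (hε ▸ hu q')).mul hη,
      ((hv q).of_mul (hκ ▸ hv q')).mul hθ, ?_⟩
    rw [hm q', hm q, ← mul_assoc, Matrix.mul_fin_two]
    ext i j : 1
    simp only [mul_zero, zero_mul, add_zero, zero_add]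
    fin_cases i
    · simp only [Fin.zero_eta]
      rw [hrow0, hrow0, e1, ← hε, Units.val_mul]
      ring
    · simp only [Fin.mk_one]
      rw [hrow1, hrow1, e2, ← hκ, Units.val_mul]
      ring
  have hsupp : Function.support G ⊆ Set.range Φ := by
    rintro ⟨⟨I₁, hI₁⟩, ⟨I₂, hI₂⟩, p⟩ ht
    induction p using Quot.ind with
    | mk p =>
      obtain ⟨a, b⟩ := p
      obtain ⟨x, hx, rfl⟩ := hF.2.2 I₁ hI₁
      obtain ⟨y, hy, rfl⟩ := hF.2.2 I₂ hI₂
      have hpos : TotPos F σ₁ σ₂ (lowc F a b) := by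
        by_contra hc
        apply ht
        simp only [G]
        rw [hE, dblExt, if_neg hc, mul_zero, mul_zero]
      let m : Mplus F σ₁ σ₂ := ⟨!![x, 0; 0, y] * lowerRows a b, by
        rwa [totPos_diag_mul hx hy, det_lowerRows]⟩
      refine ⟨Quot.mk _ m, ?_⟩
      set q : Quot (AtildeRel F σ₁ σ₂) := Quot.mk _ m
      obtain ⟨ε, κ, hε, hκ, e⟩ : AtildeRel F σ₁ σ₂ m q.out :=
        (atildeRel_equivalence.quot_mk_eq_iff _ _).1 (Quot.out_eq q).symm
      have e' : !![u q, 0; 0, v q] * lowerRows (γ q) (δ q) =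
          !![ε * x, 0; 0, κ * y] * lowerRows a b := by
        rw [← hm, e, ← mul_assoc, Matrix.mul_fin_two]
        simp
      obtain ⟨i1, r1⟩ := row_factor_unique (hu q) (hε.mul hx) (γ := γ q) (γ' := a) fun j ↦ by
        rw [← hrow0 _ (v q) _ (δ q), e', hrow0]
      obtain ⟨i2, r2⟩ := row_factor_unique (hv q) (hκ.mul hy) (γ := δ q) (γ' := b) fun j ↦ by
        rw [← hrow1 (u q) _ (γ q), e', hrow1]
      rw [Ideal.span_singleton_mul_left_unit ε.isUnit] at i1
      rw [Ideal.span_singleton_mul_left_unit κ.isUnit] at i2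
      simp only [Φ, Prod.mk.injEq]
      exact ⟨Subtype.ext i1, Subtype.ext i2, Quot.sound ⟨r1, r2⟩⟩
  have hGs : Summable G := by
    rw [← hinj.summable_iff fun t ht ↦ ?_]
    · exact hs.congr fun q ↦ (hGΦ q).symm
    · by_contra hc
      exact ht (hsupp hc)
  calc _ = ∑' t, G t := by
        rw [hGs.tsum_prod]
        simp_rw [fun b ↦ (hGs.prod_factor b).tsum_prod]
        simp only [G, tsum_mul_left, tsum_mul_right]
        rw [mul_assoc]
        rfl
    _ = ∑' q, G (Φ q) := (hinj.tsum_eq hsupp).symm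
    _ = _ := tsum_congr hGΦ

end Main

/-- For even `k ≥ 6`, `2 < Re s < k-2`,
`Re w < min (Re s - 1) (k - 1 - Re s)` and `z ∈ ℍ²`:
`ζ_F(1-w+s) ζ_F(1-w+k-s) E_{s,k-s}(z;w)
  = Σ_{γ ∈ Ã\M⁺} (σ₁ det γ)^{w-1} (σ₂ det γ)^{w-1} (γ₁z₁)^{-s} (γ₂z₂)^{-s} j(γ,z)^{-k·1}`,
the summand being Ã-invariant and the right-hand series absolutely convergent. -/
theorem statement5 (σ₁ σ₂ : F →+* ℝ) (hF : RealQuadNarrowOne F σ₁ σ₂)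
    (k : ℕ) (hkeven : Even k) (hk6 : 6 ≤ k)
    (s w : ℂ) (hs1 : 2 < s.re) (hs2 : s.re < (k : ℝ) - 2)
    (hw : w.re < min (s.re - 1) ((k : ℝ) - 1 - s.re))
    (z₁ z₂ : ℂ) (hz₁ : 0 < z₁.im) (hz₂ : 0 < z₂.im)
    (E : Quot (PairRel F σ₁ σ₂) → ℂ)
    (hE : ∀ p : SL2O F × SL2O F, E (Quot.mk _ p) = dblExt F σ₁ σ₂ k s w z₁ z₂ p.1 p.2) :
    (∀ m m' : Mplus F σ₁ σ₂, AtildeRel F σ₁ σ₂ m m' →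
        mplusSummand F σ₁ σ₂ k s w z₁ z₂ m.1 = mplusSummand F σ₁ σ₂ k s w z₁ z₂ m'.1) ∧
    (∀ g : Quot (AtildeRel F σ₁ σ₂) → ℂ,
        (∀ m : Mplus F σ₁ σ₂, g (Quot.mk _ m) = mplusSummand F σ₁ σ₂ k s w z₁ z₂ m.1) →
        Summable g ∧
        zetaVal F (1 - w + s) * zetaVal F (1 - w + (k : ℂ) - s) * ∑' q, E q = ∑' q, g q) := by
  obtain ⟨hd, h, -⟩ := id hF
  refine ⟨fun m m' ↦ atildeRel_summand hd h k s w z₁ z₂, fun g hg ↦ ?_⟩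
  obtain ⟨hw1, hw2⟩ := lt_min_iff.1 hw
  have hs := summable_of_summand hd h k s w hz₁ hz₂
    (by rcases max_cases (w.re - 1) 0 with ⟨e, -⟩ | ⟨e, -⟩ <;> rw [e] <;> linarith)
    (by rcases max_cases (w.re - 1) 0 with ⟨e, -⟩ | ⟨e, -⟩ <;> rw [e] <;> linarith) g hg
  exact ⟨hs, tsum_eq_of_summable hF k s w z₁ z₂ E hE g hg hs⟩

end HilbertPaper
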